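/- arXiv:1211.1355 — 4 statements merged into one kernel-verified Lean document; each statement's English description precedes it below -/
import Mathlib

section
/- Let g : [0, F^max] → [0, ρ*] be continuous, convex, strictly increasing with g(0) = 0 and F^max > 0, let g*(p) := max_{u ∈ [0, F^max]} (p·u − g(u)), and let L > 0. Define h(s) := −L·g*(−s/L) and μ := L·m, where m := inf_{u ∈ (0, F^max]} g(u)/u is assumed finite and positive. Then h is concave, nondecreasing, and nonpositive on ℝ; moreover h(s) = 0 for every s ≥ −μ, and h(s) < 0 for every s < −μ. -/
open Set

section LegendreTransform

variable {g gstar : ℝ → ℝ} {b : ℝ}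

theorem convexOn_of_isGreatest_legendre {s : Set ℝ}
    (hgstar : ∀ p : ℝ, IsGreatest ((fun u => p * u - g u) '' s) (gstar p)) :
    ConvexOn ℝ univ gstar := by
  refine ⟨convex_univ, fun x _ y _ a c ha hc hac => ?_⟩
  obtain ⟨u, hu, hval⟩ := (hgstar (a • x + c • y)).1
  have hx : x * u - g u ≤ gstar x := (hgstar x).2 (mem_image_of_mem _ hu)
  have hy : y * u - g u ≤ gstar y := (hgstar y).2 (mem_image_of_mem _ hu)
  rw [← hval]
  simp only [smul_eq_mul]
  calc (a * x + c * y) * u - g u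
      = a * (x * u - g u) + c * (y * u - g u) + (a + c - 1) * g u := by ring
    _ = a * (x * u - g u) + c * (y * u - g u) := by rw [hac]; ring
    _ ≤ a * gstar x + c * gstar y := by gcongr

theorem monotone_of_isGreatest_legendre
    (hgstar : ∀ p : ℝ, IsGreatest ((fun u => p * u - g u) '' Icc 0 b) (gstar p)) :
    Monotone gstar := by
  intro p q hpq
  obtain ⟨u, hu, hval⟩ := (hgstar p).1
  have hq : q * u - g u ≤ gstar q := (hgstar q).2 (mem_image_of_mem _ hu)
  have hmul := mul_le_mul_of_nonneg_right hpq hu.1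
  simp only at hval
  linarith

theorem legendre_nonneg (hb : 0 ≤ b) (hg0 : g 0 = 0)
    (hgstar : ∀ p : ℝ, IsGreatest ((fun u => p * u - g u) '' Icc 0 b) (gstar p)) (p : ℝ) :
    0 ≤ gstar p := by
  have h0 : p * 0 - g 0 ≤ gstar p := (hgstar p).2 (mem_image_of_mem _ ⟨le_rfl, hb⟩)
  simpa [hg0] using h0

theorem legendre_eq_zero_of_le_sInf (hb : 0 ≤ b) (hg0 : g 0 = 0)
    (hg : ∀ u ∈ Icc 0 b, 0 ≤ g u)
    (hgstar : ∀ p : ℝ, IsGreatest ((fun u => p * u - g u) '' Icc 0 b) (gstar p))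
    {p : ℝ} (hp : p ≤ sInf ((fun u => g u / u) '' Ioc 0 b)) :
    gstar p = 0 := by
  refine le_antisymm ?_ (legendre_nonneg hb hg0 hgstar p)
  obtain ⟨u, hu, hval⟩ := (hgstar p).1
  rw [← hval]
  rcases hu.1.eq_or_lt with rfl | hpos
  · simp [hg0]
  · have hbdd : BddBelow ((fun u => g u / u) '' Ioc 0 b) := by
      refine ⟨0, ?_⟩
      rintro _ ⟨v, hv, rfl⟩
      exact div_nonneg (hg v (Ioc_subset_Icc_self hv)) hv.1.le
    have hle : p ≤ g u / u := hp.trans (csInf_le hbdd (mem_image_of_mem _ ⟨hpos, hu.2⟩))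
    exact sub_nonpos.2 ((le_div_iff₀ hpos).1 hle)

theorem legendre_pos_of_sInf_lt (hb : 0 < b)
    (hgstar : ∀ p : ℝ, IsGreatest ((fun u => p * u - g u) '' Icc 0 b) (gstar p))
    {p : ℝ} (hp : sInf ((fun u => g u / u) '' Ioc 0 b) < p) :
    0 < gstar p := by
  obtain ⟨_, ⟨u, hu, rfl⟩, hlt⟩ :=
    exists_lt_of_csInf_lt ((nonempty_Ioc.2 hb).image _) hp
  exact (sub_pos.2 ((div_lt_iff₀ hu.1).1 hlt)).trans_le
    ((hgstar p).2 (mem_image_of_mem _ (Ioc_subset_Icc_self hu)))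

end LegendreTransform

/-- Properties (4.5)-(4.6) of the kernel `h(s) = −L·g*(−s/L)`, with `μ = L·m`,
`m = inf_{u ∈ (0, F^max]} g(u)/u` finite and positive: `h` is concave, nondecreasing,
nonpositive, vanishes for `s ≥ −μ`, and is strictly negative for `s < −μ`. -/
theorem kernel_h_properties
    (Fmax ρstar L : ℝ) (hFmax : 0 < Fmax) (hL : 0 < L)
    (g : ℝ → ℝ)
    (hgmap : ∀ u ∈ Icc 0 Fmax, g u ∈ Icc 0 ρstar)
    (hgcont : ContinuousOn g (Icc 0 Fmax))
    (hgconv : ConvexOn ℝ (Icc 0 Fmax) g)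
    (hgmono : StrictMonoOn g (Icc 0 Fmax))
    (hg0 : g 0 = 0)
    (gstar : ℝ → ℝ)
    (hgstar : ∀ p : ℝ, IsGreatest ((fun u => p * u - g u) '' Icc 0 Fmax) (gstar p))
    (m : ℝ) (hm : m = sInf ((fun u => g u / u) '' Ioc 0 Fmax)) (hmpos : 0 < m)
    (h : ℝ → ℝ) (hdef : ∀ s, h s = -L * gstar (-s / L))
    (μ : ℝ) (hμ : μ = L * m) :
    ConcaveOn ℝ univ h ∧
    Monotone h ∧
    (∀ s, h s ≤ 0) ∧
    (∀ s, -μ ≤ s → h s = 0) ∧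
    (∀ s, s < -μ → h s < 0) := by
  obtain rfl : h = fun s => -L * gstar (-s / L) := funext hdef
  subst hμ hm
  refine ⟨⟨convex_univ, fun x _ y _ a c ha hc hac => ?_⟩, fun x y hxy => ?_, fun s => ?_,
    fun s hs => ?_, fun s hs => ?_⟩
  · have hconv := (convexOn_of_isGreatest_legendre hgstar).2
      (mem_univ (-x / L)) (mem_univ (-y / L)) ha hc hac
    have harg : a • (-x / L) + c • (-y / L) = -(a • x + c • y) / L := by
      simp only [smul_eq_mul]; ring
    rw [harg] at hconv
    have hmul := mul_le_mul_of_nonneg_left hconv hL.le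
    simp only [smul_eq_mul] at hmul ⊢
    linarith
  · have hle : gstar (-y / L) ≤ gstar (-x / L) :=
      monotone_of_isGreatest_legendre hgstar (by gcongr)
    exact mul_le_mul_of_nonpos_left hle (neg_nonpos.2 hL.le)
  · exact mul_nonpos_of_nonpos_of_nonneg (neg_nonpos.2 hL.le)
      (legendre_nonneg hFmax.le hg0 hgstar _)
  · have hle := (div_le_iff₀' hL).2 (neg_le.1 hs)
    simp only [legendre_eq_zero_of_le_sInf hFmax.le hg0 (fun u hu => (hgmap u hu).1) hgstar hle,
      mul_zero]
  · have hlt := (lt_div_iff₀' hL).2 (lt_neg.1 hs)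
    exact mul_neg_of_neg_of_pos (neg_neg_iff_pos.2 hL)
      (legendre_pos_of_sInf_lt hFmax hgstar hlt)
end

section
/- Let g : [0, F^max] → [0, ρ*] be continuous, convex, strictly increasing with g(0) = 0 and F^max > 0, let g*(p) := max_{u ∈ [0, F^max]} (p·u − g(u)), let L > 0, and set h(s) := −L·g*(−s/L) and μ := L·m with m := inf_{u ∈ (0, F^max]} g(u)/u assumed finite and positive. Then the restriction of h to the interval (−∞, −μ] is continuous, strictly increasing, and a bijection from (−∞, −μ] onto (−∞, 0]. -/
open Set

/-- The Legendre transform over `[0, F]`, as a maximum, is `F`-Lipschitz. -/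
theorem lipschitzWith_of_isGreatest_mul_sub {F : ℝ} (hF : 0 ≤ F) {g G : ℝ → ℝ}
    (hG : ∀ p : ℝ, IsGreatest ((fun u => p * u - g u) '' Icc 0 F) (G p)) :
    LipschitzWith ⟨F, hF⟩ G := by
  refine LipschitzWith.of_le_add_mul _ fun p q => ?_
  obtain ⟨u, hu, hup⟩ := (hG p).1
  have huq : q * u - g u ≤ G q := (hG q).2 ⟨u, hu, rfl⟩
  have hle : (p - q) * u ≤ F * dist p q := by
    rw [Real.dist_eq, mul_comm F]
    exact mul_le_mul (le_abs_self _) hu.2 hu.1 (abs_nonneg _)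
  change G p ≤ G q + F * dist p q
  simp only at hup
  linarith

/-- The Legendre transform over `[0, F]` vanishes at a slope `m` below all `g u / u`. -/
theorem eq_zero_of_isGreatest_mul_sub {F : ℝ} (hF : 0 ≤ F) {g G : ℝ → ℝ} (hg0 : g 0 = 0)
    (hG : ∀ p : ℝ, IsGreatest ((fun u => p * u - g u) '' Icc 0 F) (G p)) {m : ℝ}
    (hm : ∀ u ∈ Ioc 0 F, m ≤ g u / u) : G m = 0 := by
  refine (hG m).unique ⟨⟨0, ⟨le_rfl, hF⟩, by simp [hg0]⟩, ?_⟩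
  rintro _ ⟨u, hu, rfl⟩
  rcases hu.1.eq_or_lt with rfl | h0
  · simp [hg0]
  · exact sub_nonpos.2 ((le_div_iff₀ h0).1 (hm u ⟨h0, hu.2⟩))

/-- The Legendre transform over `[0, F]` is strictly increasing on the slopes above
`m = inf g u / u`. -/
theorem strictMonoOn_of_isGreatest_mul_sub {F : ℝ} {g G : ℝ → ℝ} (hg0 : g 0 = 0)
    (hG : ∀ p : ℝ, IsGreatest ((fun u => p * u - g u) '' Icc 0 F) (G p)) {m : ℝ}
    (hm : IsGLB ((fun u => g u / u) '' Ioc 0 F) m) : StrictMonoOn G (Ici m) := by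
  intro q hq p _ hqp
  obtain ⟨u, hu, huq⟩ := (hG q).1
  simp only at huq
  rcases hu.1.eq_or_lt with rfl | h0
  · obtain ⟨_, ⟨v, hv, rfl⟩, hvp⟩ := (isGLB_lt_iff hm).1 (lt_of_le_of_lt hq hqp)
    have hv' : p * v - g v ≤ G p := (hG p).2 ⟨v, ⟨hv.1.le, hv.2⟩, rfl⟩
    have := (div_lt_iff₀ hv.1).1 hvp
    rw [hg0] at huq
    linarith
  · have hup : p * u - g u ≤ G p := (hG p).2 ⟨u, hu, rfl⟩
    have := mul_lt_mul_of_pos_right hqp h0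
    linarith

/-- The Legendre transform over `[0, F]` maps the slopes above `m` onto `[0, ∞)`
when it vanishes at `m`. -/
theorem surjOn_of_isGreatest_mul_sub {F : ℝ} (hF : 0 < F) {g G : ℝ → ℝ}
    (hG : ∀ p : ℝ, IsGreatest ((fun u => p * u - g u) '' Icc 0 F) (G p)) {m : ℝ}
    (hm : G m = 0) : SurjOn G (Ici m) (Ici 0) := by
  intro y hy
  set P := max m ((y + g F) / F)
  have hP : P * F - g F ≤ G P := (hG P).2 ⟨F, ⟨hF.le, le_rfl⟩, rfl⟩
  have hyP : y + g F ≤ P * F := (div_le_iff₀ hF).1 (le_max_right _ _)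
  obtain ⟨p, hp, rfl⟩ := intermediate_value_Icc (le_max_left m ((y + g F) / F))
    (lipschitzWith_of_isGreatest_mul_sub hF.le hG).continuous.continuousOn
    (show y ∈ Icc (G m) (G P) from ⟨hm.le.trans hy, by linarith⟩)
  exact ⟨p, hp.1, rfl⟩

/-- The kernel `h(s) = −L·g*(−s/L)`, restricted to `(−∞, −μ]` with `μ = L·m`,
`m = inf_{u ∈ (0, F^max]} g(u)/u` finite and positive, is continuous, strictly
increasing, and a bijection from `(−∞, −μ]` onto `(−∞, 0]`. -/
theorem kernel_h_bijective_on_Iic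
    (Fmax ρstar L : ℝ) (hFmax : 0 < Fmax) (hL : 0 < L)
    (g : ℝ → ℝ)
    (hgmap : ∀ u ∈ Icc 0 Fmax, g u ∈ Icc 0 ρstar)
    (hgcont : ContinuousOn g (Icc 0 Fmax))
    (hgconv : ConvexOn ℝ (Icc 0 Fmax) g)
    (hgmono : StrictMonoOn g (Icc 0 Fmax))
    (hg0 : g 0 = 0)
    (gstar : ℝ → ℝ)
    (hgstar : ∀ p : ℝ, IsGreatest ((fun u => p * u - g u) '' Icc 0 Fmax) (gstar p))
    (m : ℝ) (hm : m = sInf ((fun u => g u / u) '' Ioc 0 Fmax)) (hmpos : 0 < m)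
    (h : ℝ → ℝ) (hdef : ∀ s, h s = -L * gstar (-s / L))
    (μ : ℝ) (hμ : μ = L * m) :
    ContinuousOn h (Iic (-μ)) ∧
    StrictMonoOn h (Iic (-μ)) ∧
    Set.BijOn h (Iic (-μ)) (Iic 0) := by
  have hglb : IsGLB ((fun u => g u / u) '' Ioc 0 Fmax) m := by
    rw [hm]
    refine isGLB_csInf ⟨_, Fmax, ⟨hFmax, le_rfl⟩, rfl⟩ ⟨0, ?_⟩
    rintro _ ⟨u, hu, rfl⟩
    exact div_nonneg (hgmap u ⟨hu.1.le, hu.2⟩).1 hu.1.le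
  have hzero : gstar m = 0 :=
    eq_zero_of_isGreatest_mul_sub hFmax.le hg0 hgstar fun u hu => hglb.1 ⟨u, hu, rfl⟩
  have hmono := strictMonoOn_of_isGreatest_mul_sub hg0 hgstar hglb
  have hcont : Continuous gstar :=
    (lipschitzWith_of_isGreatest_mul_sub hFmax.le hgstar).continuous
  have hslope : ∀ s ∈ Iic (-μ), m ≤ -s / L := by
    intro s hs
    rw [le_div_iff₀ hL]
    have : s ≤ -μ := hs
    linarith
  have hstrict : StrictMonoOn h (Iic (-μ)) := by
    intro s hs t ht hst
    rw [hdef, hdef, neg_mul, neg_mul, neg_lt_neg_iff, mul_lt_mul_iff_right₀ hL]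
    exact hmono (hslope t ht) (hslope s hs) (div_lt_div_of_pos_right (neg_lt_neg hst) hL)
  refine ⟨?_, hstrict, ?_, hstrict.injOn, ?_⟩
  · rw [funext hdef]
    fun_prop
  · intro s hs
    have hge : 0 ≤ gstar (-s / L) :=
      hzero ▸ hmono.monotoneOn self_mem_Ici (hslope s hs) (hslope s hs)
    rw [hdef, mem_Iic, neg_mul, neg_nonpos]
    exact mul_nonneg hL.le hge
  · intro y hy
    obtain ⟨p, hp, hpy⟩ := surjOn_of_isGreatest_mul_sub hFmax hgstar hzero
      (show -y / L ∈ Ici 0 from div_nonneg (neg_nonneg.2 hy) hL.le)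
    refine ⟨-(L * p), ?_, ?_⟩
    · rw [hμ]
      exact neg_le_neg (mul_le_mul_of_nonneg_left hp hL.le)
    · rw [hdef, neg_neg, mul_div_cancel_left₀ _ hL.ne', hpy]
      field_simp
end

section
/- Let F : [0, ρ̄] → ℝ be continuous, concave, nonnegative, with F(0) = F(ρ̄) = 0, attaining its maximum F^max at ρ* ∈ (0, ρ̄) and strictly increasing on [0, ρ*]; let g be the inverse of F on [0, ρ*], g* its Legendre transform, L > 0, h(s) := −L·g*(−s/L), and μ := L·inf_{u ∈ (0, F^max]} g(u)/u, assumed finite and positive. Given constants M, G > 0, there exists a continuous function φ : [0, ∞) → [0, ∞), depending only on F, L, M, G, with φ(0) = 0, such that the following holds. For every nondecreasing Lipschitz function U⁻ : ℝ → [0, G] with Lipschitz constant at most M, the exit time τ(t) := max( t + μ , inf{ τ̄ : U⁻(s) ≥ U⁻(t) + h(s − τ̄) for all s < t } ) satisfies τ(t₂) − τ(t₁) ≤ φ(t₂ − t₁) whenever t₁ ≤ t₂. -/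
open Set

/-- Exit time (4.7) of the paper: the driver entering the road at time `t`, with cumulative
entrance distribution `U`, exits at time
`τ(t) = max( t + μ , inf{ τ̄ : U(s) ≥ U(t) + h(s − τ̄) for all s < t } )`. -/
noncomputable def exitTime (h : ℝ → ℝ) (μ : ℝ) (U : ℝ → ℝ) (t : ℝ) : ℝ :=
  max (t + μ) (sInf {τbar : ℝ | ∀ s < t, U t + h (s - τbar) ≤ U s})

open Filter

/-- A continuous strictly increasing function on `[0, ∞)` that vanishes at `0` and tends to `∞`
has a continuous right inverse. -/
lemma exists_continuous_rightInverse_of_strictMonoOn {k : ℝ → ℝ} (hk : Continuous k)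
    (hmono : StrictMonoOn k (Ici 0)) (hk0 : k 0 = 0) (htop : Tendsto k atTop atTop) :
    ∃ ψ : ℝ → ℝ, Continuous ψ ∧ ψ 0 = 0 ∧ ∀ y, 0 ≤ y → 0 ≤ ψ y ∧ k (ψ y) = y := by
  let K : ℝ → ℝ := fun x => k (max x 0) + min x 0
  have hKpos : ∀ x, 0 ≤ x → K x = k x := fun x hx => by simp [K, hx]
  have hKneg : ∀ x, x ≤ 0 → K x = x := fun x hx => by simp [K, hx, hk0]
  have hKcont : Continuous K := by fun_prop
  have hKmono : StrictMono K := by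
    intro x y hxy
    rcases le_or_gt 0 x with hx | hx
    · rw [hKpos x hx, hKpos y (hx.trans hxy.le)]
      exact hmono hx (hx.trans hxy.le) hxy
    · rw [hKneg x hx.le]
      rcases le_or_gt y 0 with hy | hy
      · rwa [hKneg y hy]
      · rw [hKpos y hy.le]
        have := hmono self_mem_Ici hy.le hy
        linarith
  have hKsurj : Function.Surjective K := by
    refine hKcont.surjective ?_ ?_
    · refine htop.congr' ?_
      filter_upwards [eventually_ge_atTop 0] with x hx using (hKpos x hx).symm
    · refine tendsto_id.congr' ?_
      filter_upwards [eventually_le_atBot 0] with x hx using (hKneg x hx).symm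
  let e := hKmono.orderIsoOfSurjective K hKsurj
  have hKe : ∀ y, K (e.symm y) = y := fun y => e.apply_symm_apply y
  refine ⟨e.symm, e.symm.continuous, ?_, fun y hy => ?_⟩
  · apply hKmono.injective
    rw [hKe, hKneg 0 le_rfl]
  · have hnonneg : 0 ≤ e.symm y := by
      rw [← hKmono.le_iff_le, hKe, hKneg 0 le_rfl]
      exact hy
    exact ⟨hnonneg, by rw [← hKpos _ hnonneg, hKe]⟩

section Legendre

variable {c : ℝ} {g gstar : ℝ → ℝ}

lemma mul_sub_le_legendre
    (hgstar : ∀ p : ℝ, IsGreatest ((fun u => p * u - g u) '' Icc 0 c) (gstar p))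
    (p : ℝ) {u : ℝ} (hu : u ∈ Icc 0 c) : p * u - g u ≤ gstar p :=
  (hgstar p).2 (mem_image_of_mem _ hu)

lemma exists_legendre_eq
    (hgstar : ∀ p : ℝ, IsGreatest ((fun u => p * u - g u) '' Icc 0 c) (gstar p))
    (p : ℝ) : ∃ u ∈ Icc 0 c, gstar p = p * u - g u := by
  obtain ⟨u, hu, hpu⟩ := (hgstar p).1
  exact ⟨u, hu, hpu.symm⟩

lemma legendre_monotone
    (hgstar : ∀ p : ℝ, IsGreatest ((fun u => p * u - g u) '' Icc 0 c) (gstar p)) :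
    Monotone gstar := by
  intro p q hpq
  obtain ⟨u, hu, hpu⟩ := exists_legendre_eq hgstar p
  have := mul_sub_le_legendre hgstar q hu
  nlinarith [hu.1]

lemma legendre_convexOn
    (hgstar : ∀ p : ℝ, IsGreatest ((fun u => p * u - g u) '' Icc 0 c) (gstar p)) :
    ConvexOn ℝ univ gstar := by
  refine ⟨convex_univ, fun p _ q _ a b ha hb hab => ?_⟩
  obtain ⟨u, hu, hpu⟩ := exists_legendre_eq hgstar (a • p + b • q)
  have h₁ := mul_le_mul_of_nonneg_left (mul_sub_le_legendre hgstar p hu) ha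
  have h₂ := mul_le_mul_of_nonneg_left (mul_sub_le_legendre hgstar q hu) hb
  have h₃ : g u = a * g u + b * g u := by rw [← add_mul, hab, one_mul]
  rw [hpu]
  simp only [smul_eq_mul]
  linarith

lemma legendre_continuous
    (hgstar : ∀ p : ℝ, IsGreatest ((fun u => p * u - g u) '' Icc 0 c) (gstar p)) :
    Continuous gstar := by
  rw [← continuousOn_univ]
  exact (legendre_convexOn hgstar).continuousOn isOpen_univ

lemma tendsto_legendre_atTop (hc : 0 < c)
    (hgstar : ∀ p : ℝ, IsGreatest ((fun u => p * u - g u) '' Icc 0 c) (gstar p)) :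
    Tendsto gstar atTop atTop := by
  refine tendsto_atTop_mono (fun p => mul_sub_le_legendre hgstar p (right_mem_Icc.2 hc.le)) ?_
  exact tendsto_atTop_add_const_right _ _ (tendsto_id.atTop_mul_const hc)

/-- The Legendre transform vanishes at the smallest secant slope of `g` from the origin. -/
lemma legendre_sInf_slope (hc : 0 < c) (hg0 : g 0 = 0) (hg : ∀ u ∈ Icc 0 c, 0 ≤ g u)
    (hgstar : ∀ p : ℝ, IsGreatest ((fun u => p * u - g u) '' Icc 0 c) (gstar p)) :
    gstar (sInf ((fun u => g u / u) '' Ioc 0 c)) = 0 := by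
  refine (hgstar _).unique ⟨⟨0, left_mem_Icc.2 hc.le, by simp [hg0]⟩, ?_⟩
  rintro _ ⟨u, hu, rfl⟩
  rcases hu.1.eq_or_lt with rfl | hu0
  · simp [hg0]
  · have hbdd : BddBelow ((fun u => g u / u) '' Ioc 0 c) :=
      ⟨0, by rintro _ ⟨v, hv, rfl⟩; exact div_nonneg (hg v ⟨hv.1.le, hv.2⟩) hv.1.le⟩
    have := csInf_le hbdd (mem_image_of_mem (fun u => g u / u) (⟨hu0, hu.2⟩ : u ∈ Ioc 0 c))
    have := (le_div_iff₀ hu0).1 this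
    simp only
    linarith

/-- The Legendre transform is strictly increasing beyond the smallest secant slope of `g`. -/
lemma legendre_strictMonoOn (hc : 0 < c) (hg0 : g 0 = 0)
    (hgstar : ∀ p : ℝ, IsGreatest ((fun u => p * u - g u) '' Icc 0 c) (gstar p)) :
    StrictMonoOn gstar (Ici (sInf ((fun u => g u / u) '' Ioc 0 c))) := by
  intro p hp q _ hpq
  obtain ⟨u, hu, hpu⟩ := exists_legendre_eq hgstar p
  rcases hu.1.eq_or_lt with rfl | hu0
  · obtain ⟨_, ⟨v, hv, rfl⟩, hvq⟩ := exists_lt_of_csInf_lt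
      ((nonempty_Ioc.2 hc).image (fun u => g u / u)) (lt_of_le_of_lt hp hpq)
    have := mul_sub_le_legendre hgstar q ⟨hv.1.le, hv.2⟩
    have := (div_lt_iff₀ hv.1).1 hvq
    rw [hpu, hg0]
    linarith
  · have := mul_sub_le_legendre hgstar q hu
    nlinarith

end Legendre

/-- Increments of a concave function over intervals of equal length decrease. -/
lemma ConcaveOn.sub_le_sub_of_le {h : ℝ → ℝ} (hh : ConcaveOn ℝ univ h) {x y w : ℝ}
    (hxy : x ≤ y) (hw : 0 ≤ w) : h (x - w) + h y ≤ h x + h (y - w) := by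
  rcases hw.eq_or_lt with rfl | hw
  · simp
  have hd : 0 < y - x + w := by linarith
  have ha : 0 ≤ w / (y - x + w) := by positivity
  have hb : 0 ≤ (y - x) / (y - x + w) := div_nonneg (by linarith) hd.le
  have hab : w / (y - x + w) + (y - x) / (y - x + w) = 1 := by
    field_simp
    ring
  have h₁ := hh.2 (mem_univ (x - w)) (mem_univ y) hb ha (by linarith)
  have h₂ := hh.2 (mem_univ (x - w)) (mem_univ y) ha hb hab
  have e₁ : ((y - x) / (y - x + w)) • (x - w) + (w / (y - x + w)) • y = x := by
    simp only [smul_eq_mul]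
    field_simp
    ring
  have e₂ : (w / (y - x + w)) • (x - w) + ((y - x) / (y - x + w)) • y = y - w := by
    simp only [smul_eq_mul]
    field_simp
    ring
  rw [e₁] at h₁
  rw [e₂] at h₂
  simp only [smul_eq_mul] at h₁ h₂
  linear_combination h₁ + h₂ - (h (x - w) + h y) * hab

/-- If `U` grows by at most `ε` from `t₁` to `t₂`, and the kernel `h` drops by `ε` over the
interval `[-μ - w, -μ]`, then the exit time grows by at most `t₂ - t₁ + w`. -/
lemma exitTime_sub_le {h U : ℝ → ℝ} {μ w ε t₁ t₂ : ℝ} (hmono : Monotone h)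
    (hconc : ConcaveOn ℝ univ h) (hμ : h (-μ) = 0) (hw : 0 ≤ w) (hε : h (-μ - w) ≤ -ε)
    (hU : Monotone U) (ht : t₁ ≤ t₂) (hUε : U t₂ ≤ U t₁ + ε)
    (hne : {τbar : ℝ | ∀ s < t₁, U t₁ + h (s - τbar) ≤ U s}.Nonempty) :
    exitTime h μ U t₂ - exitTime h μ U t₁ ≤ t₂ - t₁ + w := by
  have hτ₁ : t₁ + μ ≤ exitTime h μ U t₁ := le_max_left _ _
  have hτ₁' : sInf {τbar : ℝ | ∀ s < t₁, U t₁ + h (s - τbar) ≤ U s} ≤ exitTime h μ U t₁ :=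
    le_max_right _ _
  rw [sub_le_iff_le_add]
  refine max_le (by linarith) ?_
  by_cases hbdd : BddBelow {τbar : ℝ | ∀ s < t₂, U t₂ + h (s - τbar) ≤ U s}
  · refine le_of_forall_pos_le_add fun η hη => csInf_le hbdd fun s hs => ?_
    have hs' : h (s - (t₂ - t₁ + w + exitTime h μ U t₁ + η))
        ≤ h (s - (exitTime h μ U t₁ + η) - w) := hmono (by linarith)
    rcases lt_or_ge s t₁ with hst | hst
    · obtain ⟨a, ha, hlt⟩ := exists_lt_of_csInf_lt hne
        (lt_of_le_of_lt hτ₁' (lt_add_of_pos_right _ hη))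
      have h₁ := ha s hst
      have h₂ : h (s - (exitTime h μ U t₁ + η)) ≤ h (s - a) := hmono (by linarith)
      have h₃ := hconc.sub_le_sub_of_le
        (show s - (exitTime h μ U t₁ + η) ≤ -μ by linarith) hw
      linarith
    · have h₁ : h (s - (t₂ - t₁ + w + exitTime h μ U t₁ + η)) ≤ h (-μ - w) :=
        hmono (by linarith)
      have h₂ := hU hst
      linarith
  · -- Both infima are over sets unbounded below, hence equal to `0` by convention.
    have hbdd₁ : ¬ BddBelow {τbar : ℝ | ∀ s < t₁, U t₁ + h (s - τbar) ≤ U s} := by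
      refine fun hb => hbdd (BddBelow.mono (fun a ha => ?_) hb)
      intro s hs
      have h₁ := ha s (hs.trans_le ht)
      have h₂ := hU ht
      linarith
    rw [Real.sInf_of_not_bddBelow hbdd]
    rw [Real.sInf_of_not_bddBelow hbdd₁] at hτ₁'
    linarith

/-- Lemma 1 of the paper: a modulus of continuity for the exit time.  Given the flux
function `F` (continuous, concave, nonnegative on `[0, ρ̄]`, vanishing at the endpoints,
maximal at `ρ* ∈ (0, ρ̄)`, strictly increasing on `[0, ρ*]`), its inverse `g` on
`[0, ρ*]`, the Legendre transform `g*`, a road length `L > 0`, the kernel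
`h(s) = −L·g*(−s/L)` and `μ = L·m` with `m = inf_{u ∈ (0, F^max]} g(u)/u` finite and
positive, and constants `M, G > 0`, there is a continuous `φ : [0, ∞) → [0, ∞)`,
`φ(0) = 0`, such that for every nondecreasing `M`-Lipschitz entrance distribution
`U⁻ : ℝ → [0, G]`, the exit time satisfies `τ(t₂) − τ(t₁) ≤ φ(t₂ − t₁)` whenever
`t₁ ≤ t₂`. -/
theorem exitTime_modulus_of_continuity
    (ρbar ρstar L M G : ℝ) (hL : 0 < L) (hM : 0 < M) (hG : 0 < G)
    (F : ℝ → ℝ)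
    (hρstar : ρstar ∈ Ioo 0 ρbar)
    (hFcont : ContinuousOn F (Icc 0 ρbar))
    (hFconc : ConcaveOn ℝ (Icc 0 ρbar) F)
    (hFnonneg : ∀ ρ ∈ Icc 0 ρbar, 0 ≤ F ρ)
    (hF0 : F 0 = 0) (hFρbar : F ρbar = 0)
    (hFmax : ∀ ρ ∈ Icc 0 ρbar, F ρ ≤ F ρstar)
    (hFmono : StrictMonoOn F (Icc 0 ρstar))
    (g : ℝ → ℝ)
    (hgmap : ∀ u ∈ Icc 0 (F ρstar), g u ∈ Icc 0 ρstar)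
    (hgF : ∀ ρ ∈ Icc 0 ρstar, g (F ρ) = ρ)
    (hFg : ∀ u ∈ Icc 0 (F ρstar), F (g u) = u)
    (gstar : ℝ → ℝ)
    (hgstar : ∀ p : ℝ, IsGreatest ((fun u => p * u - g u) '' Icc 0 (F ρstar)) (gstar p))
    (m : ℝ) (hm : m = sInf ((fun u => g u / u) '' Ioc 0 (F ρstar))) (hmpos : 0 < m)
    (h : ℝ → ℝ) (hdef : ∀ s, h s = -L * gstar (-s / L))
    (μ : ℝ) (hμ : μ = L * m) :
    ∃ φ : ℝ → ℝ,
      ContinuousOn φ (Ici 0) ∧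
      (∀ x ∈ Ici (0:ℝ), 0 ≤ φ x) ∧
      φ 0 = 0 ∧
      ∀ Uminus : ℝ → ℝ,
        Monotone Uminus →
        (∀ t, Uminus t ∈ Icc 0 G) →
        (∀ s t : ℝ, |Uminus s - Uminus t| ≤ M * |s - t|) →
        ∀ t₁ t₂ : ℝ, t₁ ≤ t₂ →
          exitTime h μ Uminus t₂ - exitTime h μ Uminus t₁ ≤ φ (t₂ - t₁) := by
  have hρ₀ : (0 : ℝ) ∈ Icc 0 ρstar := left_mem_Icc.2 hρstar.1.le
  have hc : 0 < F ρstar := by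
    have := hFmono hρ₀ (right_mem_Icc.2 hρstar.1.le) hρstar.1
    rwa [hF0] at this
  have hg0 : g 0 = 0 := by
    have := hgF 0 hρ₀
    rwa [hF0] at this
  have hgm : gstar m = 0 := by
    rw [hm]
    exact legendre_sInf_slope hc hg0 (fun u hu => (hgmap u hu).1) hgstar
  have hkh : ∀ x, h (-μ - x) = -(L * gstar (m + x / L)) := fun x => by
    rw [hdef, hμ, neg_mul, show -(-(L * m) - x) / L = m + x / L by field_simp; ring]
  have hμ0 : h (-μ) = 0 := by
    have := hkh 0
    simpa [hgm] using this
  have hmono : Monotone h := fun x y hxy => by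
    rw [hdef, hdef, neg_mul, neg_mul, neg_le_neg_iff]
    have hle : -y / L ≤ -x / L := by gcongr
    exact mul_le_mul_of_nonneg_left (legendre_monotone hgstar hle) hL.le
  have hconc : ConcaveOn ℝ univ h := by
    refine ⟨convex_univ, fun x _ y _ a b ha hb hab => ?_⟩
    have hcv := (legendre_convexOn hgstar).2 (mem_univ (-x / L)) (mem_univ (-y / L)) ha hb hab
    have e : a • (-x / L) + b • (-y / L) = -(a • x + b • y) / L := by
      simp only [smul_eq_mul]
      ring
    rw [e] at hcv
    have := mul_le_mul_of_nonneg_left hcv hL.le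
    simp only [hdef, smul_eq_mul] at this ⊢
    linarith
  obtain ⟨ψ, hψcont, hψ0, hψ⟩ := exists_continuous_rightInverse_of_strictMonoOn
    (k := fun x => L * gstar (m + x / L))
    (by have := legendre_continuous hgstar; fun_prop)
    (fun x hx y hy hxy => by
      have hmem : ∀ z ∈ Ici (0 : ℝ), m + z / L ∈ Ici m := fun z hz =>
        le_add_of_nonneg_right (div_nonneg hz hL.le)
      have hs := legendre_strictMonoOn hc hg0 hgstar
      rw [← hm] at hs
      have hlt : m + x / L < m + y / L := by gcongr
      exact mul_lt_mul_of_pos_left (hs (hmem x hx) (hmem y hy) hlt) hL)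
    (by simp [hgm])
    (((tendsto_legendre_atTop hc hgstar).comp (tendsto_atTop_add_const_left _ _
      (tendsto_id.atTop_div_const hL))).const_mul_atTop hL)
  refine ⟨fun δ => δ + ψ (M * δ), by fun_prop, fun x hx => ?_, by simp [hψ0], ?_⟩
  · exact add_nonneg hx (hψ _ (mul_nonneg hM.le hx)).1
  · intro U hU hUG hUM t₁ t₂ ht
    have hMδ : 0 ≤ M * (t₂ - t₁) := mul_nonneg hM.le (sub_nonneg.2 ht)
    refine exitTime_sub_le hmono hconc hμ0 (hψ _ hMδ).1 (ε := M * (t₂ - t₁)) ?_ hU ht ?_ ?_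
    · rw [hkh, (hψ _ hMδ).2]
    · have := (le_abs_self _).trans (hUM t₂ t₁)
      rw [abs_of_nonneg (sub_nonneg.2 ht)] at this
      linarith
    · refine ⟨t₁ + μ + ψ G, fun s hs => ?_⟩
      have h₁ : h (s - (t₁ + μ + ψ G)) ≤ h (-μ - ψ G) := hmono (by linarith)
      rw [hkh, (hψ G hG.le).2] at h₁
      linarith [(hUG t₁).2, (hUG s).1]
end

section
/- Let I = [a, b] ⊂ ℝ, let u : I → [0, ∞) be integrable, let F_max > 0, and let τ : I → ℝ satisfy τ(t₂) − τ(t₁) ≥ (1/F_max)·∫_{t₁}^{t₂} u(s) ds for all a ≤ t₁ ≤ t₂ ≤ b. Let φ, ψ : ℝ → ℝ be continuously differentiable, let φ'_max := max_{t ∈ I} |φ'(t)|, and suppose ψ'(t) ≥ ψ'_min > 0 for all t in an interval containing τ(I). Assume that the total cost φ(t) + ψ(τ(t)) is constant on I. Then u(t) ≤ φ'_max · F_max / ψ'_min for almost every t ∈ I. -/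
open Set MeasureTheory

/-- If an integrable function has nonnegative integrals over the subintervals of `[a, b]`, each
bounded by `K` times the length of the subinterval, then it is a.e. bounded by `K` on `[a, b]`. -/
lemma ae_le_of_intervalIntegral_le_mul_sub {a b K : ℝ} (hab : a ≤ b) {u : ℝ → ℝ}
    (hu : IntegrableOn u (Icc a b))
    (hnonneg : ∀ s ∈ Icc a b, ∀ t ∈ Icc a b, s ≤ t → 0 ≤ ∫ r in s..t, u r)
    (hle : ∀ s ∈ Icc a b, ∀ t ∈ Icc a b, s ≤ t → ∫ r in s..t, u r ≤ K * (t - s)) :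
    ∀ᵐ t ∂(volume.restrict (Icc a b)), u t ≤ K := by
  have hui : IntervalIntegrable u volume a b :=
    (intervalIntegrable_iff_integrableOn_Icc_of_le hab).2 hu
  have hsub : ∀ s ∈ Icc a b, ∀ t ∈ Icc a b,
      (∫ r in a..t, u r) - ∫ r in a..s, u r = ∫ r in s..t, u r := fun s hs t ht =>
    intervalIntegral.integral_interval_sub_left
      (hui.mono_set (by rw [uIcc_of_le ht.1, uIcc_of_le hab]; exact Icc_subset_Icc_right ht.2))
      (hui.mono_set (by rw [uIcc_of_le hs.1, uIcc_of_le hab]; exact Icc_subset_Icc_right hs.2))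
  rw [← Measure.restrict_congr_set Ioo_ae_eq_Icc, ae_restrict_iff' measurableSet_Ioo]
  filter_upwards [hui.ae_hasDerivAt_integral] with t ht htI
  have htab : t ∈ Icc a b := Ioo_subset_Icc_self htI
  have hd : HasDerivAt (fun x => ∫ r in a..x, u r) (u t) t :=
    ht (by rwa [uIcc_of_le hab]) a left_mem_uIcc
  have hK : 0 ≤ K := by
    have h := (hnonneg t htab b (right_mem_Icc.2 hab) htI.2.le).trans
      (hle t htab b (right_mem_Icc.2 hab) htI.2.le)
    exact nonneg_of_mul_nonneg_left h (sub_pos.2 htI.2)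
  refine (le_abs_self _).trans (hd.le_of_lip' hK ?_)
  filter_upwards [Ioo_mem_nhds htI.1 htI.2] with x hx
  have hxab : x ∈ Icc a b := Ioo_subset_Icc_self hx
  rw [hsub t htab x hxab]
  rcases le_total t x with h | h
  · rw [Real.norm_of_nonneg (hnonneg t htab x hxab h), Real.norm_of_nonneg (sub_nonneg.2 h)]
    exact hle t htab x hxab h
  · rw [intervalIntegral.integral_symm, norm_neg, Real.norm_of_nonneg (hnonneg x hxab t htab h),
      norm_sub_rev, Real.norm_of_nonneg (sub_nonneg.2 h)]
    exact hle x hxab t htab h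

/-- A priori bound of Step 2 in the proof of Theorem 2 of the paper: if on `I = [a, b]`
the arrival time `τ` satisfies `τ(t₂) − τ(t₁) ≥ (1/F_max)·∫_{t₁}^{t₂} u(s) ds`, the costs
`φ, ψ` are `C¹` with `φ'_max = max_{t ∈ I} |φ'(t)|` and `ψ' ≥ ψ'_min > 0` on an interval
containing `τ(I)`, and the total cost `φ(t) + ψ(τ(t))` is constant on `I`, then the
departure rate satisfies `u(t) ≤ φ'_max · F_max / ψ'_min` for a.e. `t ∈ I`. -/
theorem departure_rate_apriori_bound
    (a b : ℝ) (hab : a ≤ b)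
    (u : ℝ → ℝ) (Fmax : ℝ) (hFmax : 0 < Fmax)
    (hu_int : IntegrableOn u (Icc a b))
    (hu_nonneg : ∀ t ∈ Icc a b, 0 ≤ u t)
    (τ : ℝ → ℝ)
    (hτ : ∀ t₁ ∈ Icc a b, ∀ t₂ ∈ Icc a b, t₁ ≤ t₂ →
        (1 / Fmax) * ∫ s in t₁..t₂, u s ≤ τ t₂ - τ t₁)
    (φ ψ : ℝ → ℝ)
    (hφ : ContDiff ℝ 1 φ) (hψ : ContDiff ℝ 1 ψ)
    (φmax : ℝ) (hφmax : φmax = sSup ((fun t => |deriv φ t|) '' Icc a b))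
    (ψmin : ℝ) (hψmin : 0 < ψmin)
    (c d : ℝ) (hcd : τ '' Icc a b ⊆ Icc c d)
    (hψ' : ∀ s ∈ Icc c d, ψmin ≤ deriv ψ s)
    (hconst : ∀ t₁ ∈ Icc a b, ∀ t₂ ∈ Icc a b, φ t₁ + ψ (τ t₁) = φ t₂ + ψ (τ t₂)) :
    ∀ᵐ t ∂(volume.restrict (Icc a b)), u t ≤ φmax * Fmax / ψmin := by
  have hbdd : BddAbove ((fun t => |deriv φ t|) '' Icc a b) :=
    (isCompact_Icc.image (hφ.continuous_deriv le_rfl).abs).bddAbove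
  have hint_nonneg : ∀ s ∈ Icc a b, ∀ t ∈ Icc a b, s ≤ t → 0 ≤ ∫ r in s..t, u r :=
    fun s hs t ht hst => intervalIntegral.integral_nonneg hst
      fun r hr => hu_nonneg r ⟨hs.1.trans hr.1, hr.2.trans ht.2⟩
  refine ae_le_of_intervalIntegral_le_mul_sub hab hu_int hint_nonneg fun s hs t ht hst => ?_
  have hint := hτ s hs t ht hst
  have hmono : τ s ≤ τ t := sub_nonneg.1 <|
    (mul_nonneg (one_div_nonneg.2 hFmax.le) (hint_nonneg s hs t ht hst)).trans hint
  have hψ_le : ψmin * (τ t - τ s) ≤ ψ (τ t) - ψ (τ s) :=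
    (convex_Icc c d).mul_sub_le_image_sub_of_le_deriv hψ.continuous.continuousOn
      (hψ.differentiable one_ne_zero).differentiableOn
      (fun x hx => hψ' x (interior_subset hx)) _ (hcd ⟨s, hs, rfl⟩) _ (hcd ⟨t, ht, rfl⟩) hmono
  have hφ_le : |φ t - φ s| ≤ φmax * |t - s| :=
    (convex_Icc a b).norm_image_sub_le_of_norm_deriv_le
      (fun x _ => hφ.differentiable one_ne_zero x)
      (fun x hx => hφmax ▸ le_csSup hbdd ⟨x, hx, rfl⟩) hs ht
  rw [abs_of_nonneg (sub_nonneg.2 hst)] at hφ_le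
  have hτ_le : ψmin * (τ t - τ s) ≤ φmax * (t - s) := by
    linarith [neg_abs_le (φ t - φ s), hconst s hs t ht]
  rw [one_div_mul_eq_div, div_le_iff₀ hFmax] at hint
  rw [div_mul_eq_mul_div, le_div_iff₀ hψmin]
  calc (∫ r in s..t, u r) * ψmin ≤ (τ t - τ s) * Fmax * ψmin := by gcongr
    _ = ψmin * (τ t - τ s) * Fmax := by ring
    _ ≤ φmax * (t - s) * Fmax := by gcongr
    _ = φmax * Fmax * (t - s) := by ring
end
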